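/- arXiv:1706.05728 — 3 statements merged into one kernel-verified Lean document; each statement's English description precedes it below -/
import Mathlib

section
/- Define C_r as the r-th Taylor coefficient at 0 of e^{γz}/Γ(1−z). Then C_0 = 1, and for r ≥ 1, C_r = (1/r!) ∑_{k=1}^{r} (−1)^k B_{r,k}(0, 1!ζ(2), 2!ζ(3), …, (r−k)!ζ(r−k+1)), where B_{r,k} is the partial Bell polynomial. -/
/-- `C r` is the `r`-th Taylor coefficient at `0` of `e^{γz}/Γ(1-z)`. -/
noncomputable def DickmanC (r : ℕ) : ℂ :=
  iteratedDeriv r (fun z => Complex.exp ((Real.eulerMascheroniConstant : ℂ) * z) /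
    Complex.Gamma (1 - z)) 0 / (r.factorial : ℂ)

/-- The partial Bell polynomial `B_{r,k}(x_1, …, x_{r-k+1})`. -/
noncomputable def bellB (r k : ℕ) (x : ℕ → ℂ) : ℂ :=
  ∑ j ∈ (Finset.Nat.antidiagonalTuple (r - k + 1) k).filter
      (fun j => ∑ i, ((i : Fin (r - k + 1)).1 + 1) * j i = r),
    ((r.factorial : ℂ) / ∏ i, ((j i).factorial : ℂ)) *
      ∏ i, (x (i.1 + 1) / (((i : Fin (r - k + 1)).1 + 1).factorial : ℂ)) ^ (j i)

open Filter Topology Asymptotics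

theorem Polynomial.iteratedDeriv_eval_zero (p : Polynomial ℂ) (n : ℕ) :
    iteratedDeriv n (fun z => p.eval z) 0 = (n.factorial : ℂ) * p.coeff n := by
  have h : ∀ n, iteratedDeriv n (fun z => p.eval z) =
      fun z => (Polynomial.derivative^[n] p).eval z := by
    intro n
    induction n with
    | zero => simp
    | succ n ih =>
      rw [iteratedDeriv_succ, ih, Function.iterate_succ_apply']
      funext z
      simp
  simp only [h]
  rw [← Polynomial.coeff_zero_eq_eval_zero, Polynomial.coeff_iterate_derivative]
  simp [Nat.descFactorial_self]

theorem AnalyticAt.iteratedDeriv_eq_zero_of_isBigO {f : ℂ → ℂ} (hf : AnalyticAt ℂ f 0) {n : ℕ}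
    (h : f =O[𝓝 0] fun z => z ^ (n + 1)) : iteratedDeriv n f 0 = 0 := by
  suffices H : ((n + 1 : ℕ) : ℕ∞) ≤ analyticOrderAt f 0 from
    (natCast_le_analyticOrderAt_iff_iteratedDeriv_eq_zero hf).1 H n n.lt_succ_self
  by_contra! hlt
  obtain ⟨k, hk⟩ := ENat.ne_top_iff_exists.1 (hlt.trans_le le_top).ne
  rw [← hk, Nat.cast_lt] at hlt
  obtain ⟨g, hg, hg0, hfg⟩ := hf.analyticOrderAt_eq_natCast.1 hk.symm
  obtain ⟨C, hC⟩ := h.bound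
  have hlim : Tendsto (fun z : ℂ => C * ‖z ^ (n + 1 - k)‖) (𝓝[≠] 0) (𝓝 0) := by
    have : Continuous fun z : ℂ => C * ‖z ^ (n + 1 - k)‖ := by fun_prop
    have := this.tendsto 0
    rw [zero_pow (by omega), norm_zero, mul_zero] at this
    exact this.mono_left nhdsWithin_le_nhds
  have hle : ‖g 0‖ ≤ 0 := by
    refine le_of_tendsto_of_tendsto (hg.continuousAt.norm.tendsto.mono_left nhdsWithin_le_nhds)
      hlim ?_
    filter_upwards [nhdsWithin_le_nhds hfg, nhdsWithin_le_nhds hC, self_mem_nhdsWithin]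
      with z h1 h2 h3
    rw [h1, sub_zero, smul_eq_mul, norm_mul, show n + 1 = k + (n + 1 - k) by omega, pow_add,
      norm_mul] at h2
    have hz : 0 < ‖z ^ k‖ := norm_pos_iff.2 (pow_ne_zero _ h3)
    exact le_of_mul_le_mul_left (h2.trans_eq (by ring)) hz
  exact hg0 (norm_le_zero_iff.1 hle)

/-- Coefficient extraction from a power of a polynomial without constant term. -/
theorem coeff_pow_eq_bellB {r k : ℕ} (x : ℕ → ℂ) :
    ((∑ i : Fin (r - k + 1), Polynomial.C (x (i.1 + 1) / ((i.1 + 1).factorial : ℂ)) *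
      Polynomial.X ^ (i.1 + 1)) ^ k).coeff r =
      (k.factorial : ℂ) / (r.factorial : ℂ) * bellB r k x := by
  rw [Finset.sum_pow_eq_sum_piAntidiag, Finset.piAntidiag_univ_fin_eq_antidiagonalTuple,
    Polynomial.finsetSum_coeff, bellB, Finset.mul_sum, Finset.sum_filter]
  refine Finset.sum_congr rfl fun j hj => ?_
  rw [Finset.Nat.mem_antidiagonalTuple] at hj
  have hm : (Nat.multinomial Finset.univ j : ℂ) = k.factorial / ∏ i, ((j i).factorial : ℂ) := by
    have := Nat.multinomial_spec Finset.univ j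
    rw [hj] at this
    rw [eq_div_iff (Finset.prod_ne_zero_iff.2 fun i _ => by exact_mod_cast (j i).factorial_ne_zero),
      mul_comm]
    exact_mod_cast this
  have hr : (r.factorial : ℂ) ≠ 0 := by exact_mod_cast r.factorial_ne_zero
  simp only [mul_pow, Finset.prod_mul_distrib, ← pow_mul, Finset.prod_pow_eq_pow_sum,
    ← map_pow, ← map_prod, ← Polynomial.C_eq_natCast]
  rw [← mul_assoc, ← map_mul, Polynomial.coeff_C_mul_X_pow, hm]
  simp only [eq_comm (a := r)]
  split_ifs
  · field_simp
  · rfl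

/-- A power series without constant term agrees with its truncations. -/
theorem isBigO_sub_truncation {c : ℕ → ℂ} {C : ℝ} (hc : ∀ i, ‖c i‖ ≤ C) {H : ℂ → ℂ}
    (hH : ∀ z : ℂ, ‖z‖ < 1 → HasSum (fun i => c i * z ^ (i + 1)) (H z)) (m : ℕ) :
    (fun z => H z - ∑ i ∈ Finset.range m, c i * z ^ (i + 1)) =O[𝓝 0] fun z => z ^ (m + 1) := by
  refine IsBigO.of_bound (C * 2) ?_
  filter_upwards [Metric.ball_mem_nhds (0 : ℂ) (by norm_num : (0 : ℝ) < 1 / 2)] with z hz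
  have hz : ‖z‖ < 1 / 2 := by simpa using hz
  have h1 := (hasSum_nat_add_iff' m).2 (hH z (by linarith))
  rw [← h1.tsum_eq]
  have hg := (hasSum_geometric_two).mul_left (C * ‖z ^ (m + 1)‖)
  refine (tsum_of_norm_bounded hg fun i => ?_).trans_eq (by ring)
  rw [show i + m + 1 = (m + 1) + i by ring, pow_add, norm_mul, norm_mul, norm_pow z i, ← mul_assoc]
  have : 0 ≤ C := (norm_nonneg _).trans (hc 0)
  have := hc (i + m)
  gcongr

theorem isBigO_pow_sub_pow {f g : ℂ → ℂ} (hf : f =O[𝓝 0] fun z => z)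
    (hg : g =O[𝓝 0] fun z => z) {m : ℕ} (h : (fun z => f z - g z) =O[𝓝 0] fun z => z ^ m) (k : ℕ) :
    (fun z => f z ^ (k + 1) - g z ^ (k + 1)) =O[𝓝 0] fun z => z ^ (m + k) := by
  induction k with
  | zero => simpa using h
  | succ k ih =>
    have h1 := ih.mul hf
    have h2 := (hg.pow (k + 1)).mul h
    have h3 : ∀ z : ℂ, z ^ (m + k) * z = z ^ (m + (k + 1)) := fun z => by ring
    have h4 : ∀ z : ℂ, z ^ (k + 1) * z ^ m = z ^ (m + (k + 1)) := fun z => by ring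
    refine ((h1.congr_right h3).add (h2.congr_right h4)).congr_left fun z => ?_
    ring

/-- Faà di Bruno's formula for the exponential of minus a power series. -/
theorem iteratedDeriv_eq_sum_bellB {x : ℕ → ℂ} {C : ℝ}
    (hx : ∀ i, ‖x (i + 1) / ((i + 1).factorial : ℂ)‖ ≤ C) {F H : ℂ → ℂ}
    (hH : ∀ z : ℂ, ‖z‖ < 1 →
      HasSum (fun i => x (i + 1) / ((i + 1).factorial : ℂ) * z ^ (i + 1)) (H z))
    (hF : AnalyticAt ℂ F 0) (hFH : ∀ᶠ z in 𝓝 0, F z = Complex.exp (-H z)) (r : ℕ) :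
    iteratedDeriv r F 0 = ∑ k ∈ Finset.range (r + 1), (-1 : ℂ) ^ k * bellB r k x := by
  set p : ℕ → Polynomial ℂ := fun m => ∑ i : Fin m,
    Polynomial.C (x (i.1 + 1) / ((i.1 + 1).factorial : ℂ)) * Polynomial.X ^ (i.1 + 1) with hp
  set P : Polynomial ℂ := ∑ k ∈ Finset.range (r + 1),
    Polynomial.C ((-1) ^ k / (k.factorial : ℂ)) * p (r - k + 1) ^ k with hP
  have hpeval : ∀ m z, (p m).eval z = ∑ i ∈ Finset.range m,
      x (i + 1) / ((i + 1).factorial : ℂ) * z ^ (i + 1) := fun m z => by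
    rw [Finset.sum_range]
    simp [hp, Polynomial.eval_finsetSum]
  have hHp : ∀ m, (fun z => H z - (p m).eval z) =O[𝓝 0] fun z => z ^ (m + 1) := fun m => by
    simp only [hpeval]
    exact isBigO_sub_truncation hx hH m
  have hH1 : H =O[𝓝 0] fun z => z := by simpa [hpeval] using hHp 0
  have hp1 : ∀ m, (fun z => (p m).eval z) =O[𝓝 0] fun z => z := fun m => by
    have h := ((p m).differentiable.differentiableAt (x := 0)).isBigO_sub
    simpa [hpeval] using h
  have hH0 : Tendsto (fun z => -H z) (𝓝 0) (𝓝 0) := by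
    simpa using (hH1.trans_tendsto tendsto_id).neg
  have hexp : (fun z => F z - ∑ k ∈ Finset.range (r + 1), (-H z) ^ k / (k.factorial : ℂ))
      =O[𝓝 0] fun z => z ^ (r + 1) := by
    refine (((Complex.exp_sub_sum_range_isBigO_pow (r + 1)).comp_tendsto hH0).trans
      (hH1.neg_left.pow (r + 1))).congr' ?_ EventuallyEq.rfl
    filter_upwards [hFH] with z hz
    simp [hz]
  have htrunc : (fun z => ∑ k ∈ Finset.range (r + 1),
      ((-H z) ^ k / (k.factorial : ℂ) -
        (-1) ^ k / (k.factorial : ℂ) * (p (r - k + 1)).eval z ^ k))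
      =O[𝓝 0] fun z => z ^ (r + 1) := by
    refine IsBigO.fun_sum fun k hk => ?_
    have hk := Finset.mem_range.1 hk
    have hpow : (fun z => H z ^ k - (p (r - k + 1)).eval z ^ k) =O[𝓝 0]
        fun z => z ^ (r + 1) := by
      cases k with
      | zero => simpa using isBigO_zero _ _
      | succ k =>
        refine (isBigO_pow_sub_pow hH1 (hp1 _) (hHp _) k).congr_right fun z => ?_
        congr 1
        omega
    refine (hpow.const_mul_left ((-1) ^ k / (k.factorial : ℂ))).congr_left fun z => ?_
    rw [neg_pow (H z)]
    ring
  have hFP : (fun z => F z - P.eval z) =O[𝓝 0] fun z => z ^ (r + 1) := by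
    refine (hexp.add htrunc).congr_left fun z => ?_
    rw [Finset.sum_sub_distrib]
    simp [hP, Polynomial.eval_finsetSum]
  have hPan : AnalyticAt ℂ (fun z => P.eval z) 0 := P.differentiable.analyticAt 0
  have h0 := (hF.fun_sub hPan).iteratedDeriv_eq_zero_of_isBigO hFP
  rw [iteratedDeriv_fun_sub hF.contDiffAt hPan.contDiffAt, sub_eq_zero,
    Polynomial.iteratedDeriv_eval_zero] at h0
  rw [h0, hP, Polynomial.finsetSum_coeff, Finset.mul_sum]
  refine Finset.sum_congr rfl fun k _ => ?_
  rw [Polynomial.coeff_C_mul, hp, coeff_pow_eq_bellB]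
  have h1 : (r.factorial : ℂ) ≠ 0 := by exact_mod_cast r.factorial_ne_zero
  have h2 : (k.factorial : ℂ) ≠ 0 := by exact_mod_cast k.factorial_ne_zero
  field_simp

theorem hasSum_riemannZeta_nat {k : ℕ} (hk : 2 ≤ k) :
    HasSum (fun j : ℕ => 1 / ((j : ℂ) + 1) ^ k) (riemannZeta k) := by
  have hs : Summable fun j : ℕ => 1 / (j : ℂ) ^ k := by
    have := (Complex.summable_one_div_nat_cpow (p := (k : ℂ))).2 (by simpa using (show 1 < k from hk))
    simpa using this
  have h := hs.hasSum
  rw [← zeta_nat_eq_tsum_of_gt_one hk] at h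
  have := (hasSum_nat_add_iff' 1).2 h
  simpa [zero_pow (by omega : k ≠ 0)] using this

theorem exists_norm_riemannZeta_nat_le : ∃ C : ℝ, ∀ k : ℕ, 2 ≤ k → ‖riemannZeta k‖ ≤ C := by
  have h1 : Summable fun j : ℕ => 1 / ((j : ℝ) + 1) ^ 2 := by
    have := (summable_nat_add_iff 1).2 (Real.summable_one_div_nat_pow.2 one_lt_two)
    simpa using this
  refine ⟨∑' j : ℕ, 1 / ((j : ℝ) + 1) ^ 2, fun k hk => ?_⟩
  rw [← (hasSum_riemannZeta_nat hk).tsum_eq]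
  refine tsum_of_norm_bounded h1.hasSum fun j => ?_
  rw [norm_div, norm_pow, norm_one, show ((j : ℂ) + 1) = ((j + 1 : ℕ) : ℂ) by push_cast; rfl,
    Complex.norm_natCast]
  push_cast
  gcongr
  linarith [(Nat.cast_nonneg j : (0 : ℝ) ≤ j)]

theorem summable_zeta_double {z : ℂ} (hz : ‖z‖ < 1) :
    Summable fun p : ℕ × ℕ => z ^ (p.2 + 2) / ((p.2 + 2 : ℕ) * ((p.1 : ℂ) + 1) ^ (p.2 + 2)) := by
  have h1 : Summable fun j : ℕ => 1 / ((j : ℝ) + 1) ^ 2 := by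
    have := (summable_nat_add_iff 1).2 (Real.summable_one_div_nat_pow.2 one_lt_two)
    simpa using this
  have h2 := summable_geometric_of_lt_one (norm_nonneg z) hz
  refine Summable.of_norm_bounded (h1.mul_of_nonneg h2 (fun j => by positivity)
    (fun i => by positivity)) fun p => ?_
  rw [norm_div, norm_mul, norm_pow, norm_pow, Complex.norm_natCast,
    show ((p.1 : ℂ) + 1) = ((p.1 + 1 : ℕ) : ℂ) by push_cast; rfl, Complex.norm_natCast,
    div_eq_inv_mul, one_div]
  have hj : (1 : ℝ) ≤ ((p.1 + 1 : ℕ) : ℝ) := by exact_mod_cast Nat.le_add_left 1 p.1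
  gcongr ?_ * ?_
  · apply inv_anti₀ (by positivity)
    calc ((p.1 : ℝ) + 1) ^ 2 = 1 * ((p.1 + 1 : ℕ) : ℝ) ^ 2 := by push_cast; ring
      _ ≤ _ := by
        gcongr
        · exact_mod_cast Nat.le_add_left 1 (p.2 + 1)
        · omega
  · exact pow_le_pow_of_le_one (norm_nonneg z) hz.le (by omega)

theorem norm_div_nat_succ_lt {z : ℂ} (hz : ‖z‖ < 1) (j : ℕ) : ‖z / ((j : ℂ) + 1)‖ < 1 := by
  rw [norm_div, show ((j : ℂ) + 1) = ((j + 1 : ℕ) : ℂ) by push_cast; rfl, Complex.norm_natCast]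
  refine (div_le_self (norm_nonneg z) ?_).trans_lt hz
  exact_mod_cast Nat.le_add_left 1 j

theorem exists_hasSum_zeta_series {z : ℂ} (hz : ‖z‖ < 1) :
    ∃ S : ℂ, HasSum (fun i : ℕ => riemannZeta (i + 2 : ℕ) / (i + 2 : ℕ) * z ^ (i + 2)) S ∧
      HasSum (fun j : ℕ => -Complex.log (1 - z / (j + 1)) - z / (j + 1)) S := by
  have hs := summable_zeta_double hz
  refine ⟨∑' p : ℕ × ℕ, z ^ (p.2 + 2) / ((p.2 + 2 : ℕ) * ((p.1 : ℂ) + 1) ^ (p.2 + 2)), ?_, ?_⟩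
  · refine ((Equiv.prodComm ℕ ℕ).hasSum_iff.2 hs.hasSum).prod_fiberwise fun i => ?_
    have := (hasSum_riemannZeta_nat (k := i + 2) (by omega)).mul_right (z ^ (i + 2) / (i + 2 : ℕ))
    convert! this using 1
    · funext j
      simp only [Function.comp, Equiv.prodComm_apply, Prod.swap]
      rw [div_mul_div_comm, one_mul, mul_comm (((j : ℂ) + 1) ^ (i + 2))]
    · ring
  · refine hs.hasSum.prod_fiberwise fun j => ?_
    have := (hasSum_nat_add_iff' 2).2
      (Complex.hasSum_taylorSeries_neg_log (norm_div_nat_succ_lt hz j))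
    simp only [Finset.sum_range_succ, Finset.sum_range_zero] at this
    convert! this using 1
    · funext i
      simp only [div_pow]
      rw [div_div, mul_comm]
    · simp

theorem tendsto_harmonic_succ_sub_log :
    Tendsto (fun n : ℕ => (harmonic (n + 1) : ℝ) - Real.log n) atTop
      (𝓝 Real.eulerMascheroniConstant) := by
  have h := Real.tendsto_harmonic_sub_log.add (tendsto_one_div_add_atTop_nhds_zero_nat (𝕜 := ℝ))
  rw [add_zero] at h
  refine h.congr fun n => ?_
  rw [harmonic_succ]
  push_cast
  ring

theorem exp_div_GammaSeq {z : ℂ} (hz : ‖z‖ < 1) {n : ℕ} (hn : n ≠ 0) :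
    Complex.exp (((harmonic (n + 1) : ℝ) - Real.log n : ℝ) * z) / Complex.GammaSeq (1 - z) n =
      Complex.exp (-∑ j ∈ Finset.range (n + 1), (-Complex.log (1 - z / (j + 1)) - z / (j + 1))) *
        ((n + 1 : ℂ) / n) := by
  have hne : ∀ j : ℕ, 1 - z / ((j : ℂ) + 1) ≠ 0 := fun j h => by
    have := norm_div_nat_succ_lt hz j
    rw [← sub_eq_zero.1 h] at this
    simp at this
  have hj : ∀ j : ℕ, (j : ℂ) + 1 ≠ 0 := fun j => by exact_mod_cast j.succ_ne_zero
  have hprod : ∏ j ∈ Finset.range (n + 1), (1 - z + j) =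
      (n + 1).factorial * ∏ j ∈ Finset.range (n + 1), (1 - z / ((j : ℂ) + 1)) := by
    rw [← Finset.prod_range_add_one_eq_factorial, Nat.cast_prod, ← Finset.prod_mul_distrib]
    refine Finset.prod_congr rfl fun j _ => ?_
    have := hj j
    push_cast
    field_simp
    ring
  have hexp : Complex.exp (-∑ j ∈ Finset.range (n + 1),
      (-Complex.log (1 - z / (j + 1)) - z / (j + 1))) =
      (∏ j ∈ Finset.range (n + 1), (1 - z / ((j : ℂ) + 1))) *
        Complex.exp ((harmonic (n + 1) : ℝ) * z) := by
    rw [← Finset.sum_neg_distrib]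
    simp only [neg_sub, sub_neg_eq_add]
    rw [Finset.sum_add_distrib, Complex.exp_add, mul_comm, Complex.exp_sum]
    congr 1
    · exact Finset.prod_congr rfl fun j _ => Complex.exp_log (hne j)
    · rw [harmonic]
      push_cast
      rw [Finset.sum_mul]
      congr 1
      exact Finset.sum_congr rfl fun j _ => by rw [div_eq_inv_mul]
  have hn' : (n : ℂ) ≠ 0 := by exact_mod_cast hn
  have hcpow : (n : ℂ) ^ (1 - z) = n * Complex.exp (-(Real.log n * z)) := by
    rw [Complex.cpow_def_of_ne_zero hn', mul_sub, mul_one, sub_eq_add_neg, Complex.exp_add,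
      Complex.exp_log hn', Complex.ofReal_log (Nat.cast_nonneg n), Complex.ofReal_natCast]
  rw [Complex.GammaSeq, hprod, hexp, hcpow, Complex.ofReal_sub, sub_mul, sub_eq_add_neg,
    Complex.exp_add, Nat.factorial_succ]
  have h1 : (n.factorial : ℂ) ≠ 0 := by exact_mod_cast n.factorial_ne_zero
  have h2 := Complex.exp_ne_zero (-(Real.log n * z))
  push_cast
  push_cast at h2
  field_simp

/-- The Weierstrass product, in logarithmic form. -/
theorem exp_div_Gamma_one_sub {z S : ℂ} (hz : ‖z‖ < 1)
    (hS : HasSum (fun j : ℕ => -Complex.log (1 - z / (j + 1)) - z / (j + 1)) S) :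
    Complex.exp ((Real.eulerMascheroniConstant : ℂ) * z) / Complex.Gamma (1 - z) =
      Complex.exp (-S) := by
  have hG : Complex.Gamma (1 - z) ≠ 0 := Complex.Gamma_ne_zero_of_re_pos (by
    have := (Complex.re_le_norm z).trans_lt hz
    simpa using this)
  have hγ := (((Complex.continuous_ofReal.tendsto _).comp tendsto_harmonic_succ_sub_log).mul_const
    z).cexp.div (Complex.GammaSeq_tendsto_Gamma (1 - z)) hG
  have hr : Tendsto (fun n : ℕ => ((n : ℂ) + 1) / n) atTop (𝓝 1) := by
    have h := (tendsto_inv_atTop_nhds_zero_nat (𝕜 := ℂ)).const_add 1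
    rw [add_zero] at h
    refine h.congr' ?_
    filter_upwards [eventually_ne_atTop 0] with n hn
    have hn' : (n : ℂ) ≠ 0 := by exact_mod_cast hn
    field_simp
  have hp := ((hS.tendsto_sum_nat.comp (tendsto_add_atTop_nat 1)).neg.cexp).mul hr
  rw [mul_one] at hp
  refine tendsto_nhds_unique hγ (hp.congr' ?_)
  filter_upwards [eventually_ne_atTop 0] with n hn
  exact (exp_div_GammaSeq hz hn).symm

theorem differentiable_exp_div_Gamma_one_sub (a : ℂ) :
    Differentiable ℂ fun z => Complex.exp (a * z) / Complex.Gamma (1 - z) := by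
  simp only [div_eq_mul_inv]
  have := Complex.differentiable_one_div_Gamma.comp ((differentiable_const (1 : ℂ)).sub
    differentiable_id)
  exact (by fun_prop : Differentiable ℂ fun z : ℂ => Complex.exp (a * z)).mul this

theorem stmt_6 :
    DickmanC 0 = 1 ∧
    ∀ r : ℕ, 1 ≤ r →
      DickmanC r = (1 / (r.factorial : ℂ)) *
        ∑ k ∈ Finset.Icc 1 r, (-1 : ℂ) ^ k *
          bellB r k (fun i => if i = 1 then 0 else ((i - 1).factorial : ℂ) * riemannZeta i) := by
  refine ⟨by simp [DickmanC], fun r hr => ?_⟩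
  set x : ℕ → ℂ := fun i => if i = 1 then 0 else ((i - 1).factorial : ℂ) * riemannZeta i with hxdef
  have hx0 : x (0 + 1) / ((0 + 1).factorial : ℂ) = 0 := by simp [hxdef]
  have hx : ∀ i, x (i + 2) / ((i + 2).factorial : ℂ) = riemannZeta (i + 2 : ℕ) / (i + 2 : ℕ) := by
    intro i
    have h1 : ((i + 1).factorial : ℂ) ≠ 0 := by exact_mod_cast (i + 1).factorial_ne_zero
    have h2 : ((i + 2 : ℕ) : ℂ) ≠ 0 := by exact_mod_cast (i + 1).succ_ne_zero
    simp only [hxdef]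
    rw [if_neg (by omega), Nat.factorial_succ (i + 1), show i + 2 - 1 = i + 1 by omega,
      Nat.cast_mul]
    field_simp
  obtain ⟨C, hC⟩ := exists_norm_riemannZeta_nat_le
  have hbound : ∀ i, ‖x (i + 1) / ((i + 1).factorial : ℂ)‖ ≤ C := by
    intro i
    cases i with
    | zero =>
      rw [hx0, norm_zero]
      exact (norm_nonneg _).trans (hC 2 le_rfl)
    | succ i =>
      rw [hx, norm_div, Complex.norm_natCast]
      refine (div_le_self (norm_nonneg _) ?_).trans (hC (i + 2) (by omega))
      exact_mod_cast Nat.le_add_left 1 (i + 1)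
  have hseries : ∀ z : ℂ, ‖z‖ < 1 → ∃ S,
      HasSum (fun i => x (i + 1) / ((i + 1).factorial : ℂ) * z ^ (i + 1)) S ∧
      Complex.exp ((Real.eulerMascheroniConstant : ℂ) * z) / Complex.Gamma (1 - z) =
        Complex.exp (-S) := by
    intro z hz
    obtain ⟨S, h1, h2⟩ := exists_hasSum_zeta_series hz
    refine ⟨S, (hasSum_nat_add_iff' 1).1 ?_, exp_div_Gamma_one_sub hz h2⟩
    rw [Finset.sum_range_one, hx0, zero_mul, sub_zero]
    exact h1.congr_fun fun i => by rw [← hx]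
  have key := iteratedDeriv_eq_sum_bellB hbound
    (H := fun z => ∑' i, x (i + 1) / ((i + 1).factorial : ℂ) * z ^ (i + 1))
    (fun z hz => (hseries z hz).choose_spec.1.summable.hasSum)
    ((differentiable_exp_div_Gamma_one_sub Real.eulerMascheroniConstant).analyticAt 0) (by
      filter_upwards [Metric.ball_mem_nhds (0 : ℂ) one_pos] with z hz
      obtain ⟨S, h1, h2⟩ := hseries z (by simpa using hz)
      rw [h2, h1.tsum_eq]) r
  have hbell0 : bellB r 0 x = 0 := by
    rw [bellB, Finset.filter_eq_empty_iff.2, Finset.sum_empty]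
    intro j hj
    rw [Finset.Nat.antidiagonalTuple_zero_right, Finset.mem_singleton] at hj
    simp [hj]
    omega
  rw [DickmanC, key, Finset.range_eq_Ico, Finset.sum_eq_sum_Ico_succ_bot r.succ_pos, hbell0,
    mul_zero, zero_add, Nat.succ_eq_add_one, zero_add, Finset.Ico_add_one_right_eq_Icc, one_div,
    div_eq_inv_mul]
end

section
/- Let ℓ ≥ 1 and define K_ℓ(u,κ) as the multiple integral (1/ℓ!)∫_{t_i ≥ 1, ∑t_i ≤ u}(u − ∑t_i)^κ ∏ dt_i/t_i, with K_0(u,κ) = u^κ. Then for u > ℓ, (d/du)(u^{−κ} K_ℓ(u,κ)) = u^{−κ−1} K_{ℓ−1}(u−1, κ), equivalently K_ℓ(u,κ) = u^κ ∫_ℓ^u t^{−κ−1} K_{ℓ−1}(t−1,κ) dt. -/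
open MeasureTheory

/-- The multiple integral `K_ℓ(u,κ)`, with the empty (`ℓ = 0`) case giving `u^κ` for `u ≥ 0`. -/
noncomputable def K (ℓ : ℕ) (u κ : ℝ) : ℝ :=
  (1 / (ℓ.factorial : ℝ)) *
    ∫ t in {t : Fin ℓ → ℝ | (∀ i, 1 ≤ t i) ∧ ∑ i, t i ≤ u}, (u - ∑ i, t i) ^ κ / ∏ i, t i

open Set

/-- The density `1/t` on `[1, ∞)`. -/
noncomputable def invTail (t : ℝ) : ENNReal := (Ici 1).indicator (fun t => ENNReal.ofReal t⁻¹) t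

/-- The `[0, ∞]`-valued version of `ℓ! * K_ℓ(u, κ)`, as an iterated convolution. -/
noncomputable def iterK (κ : ℝ) : ℕ → ℝ → ENNReal
  | 0, u => (Ici 0).indicator (fun u => ENNReal.ofReal (u ^ κ)) u
  | n + 1, u => ∫⁻ t, invTail t * iterK κ n (u - t)

/-- The primitive of `F` vanishing at `-∞`. -/
noncomputable def prim (F : ℝ → ENNReal) (u : ℝ) : ENNReal := ∫⁻ s in Ioi 0, F (u - s)

lemma measurable_invTail : Measurable invTail :=
  (ENNReal.measurable_ofReal.comp measurable_inv).indicator measurableSet_Ici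

lemma measurable_iterK (κ : ℝ) (n : ℕ) : Measurable (iterK κ n) := by
  induction n with
  | zero =>
    exact (ENNReal.measurable_ofReal.comp (by fun_prop)).indicator measurableSet_Ici
  | succ n ih =>
    have := measurable_invTail
    exact Measurable.lintegral_prod_right' (f := fun p : ℝ × ℝ => invTail p.2 * iterK κ n (p.1 - p.2))
      (by fun_prop)

lemma measurable_prim {F : ℝ → ENNReal} (hF : Measurable F) : Measurable (prim F) :=
  Measurable.lintegral_prod_right' (f := fun p : ℝ × ℝ => F (p.1 - p.2)) (by fun_prop)

lemma iterK_eq_zero (κ : ℝ) (n : ℕ) {u : ℝ} (hu : u < n) : iterK κ n u = 0 := by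
  induction n generalizing u with
  | zero => exact indicator_of_notMem (by simpa using hu) _
  | succ n ih =>
    have : ∀ t, invTail t * iterK κ n (u - t) = 0 := fun t => by
      by_cases ht : 1 ≤ t
      · rw [ih (by push_cast at hu; linarith), mul_zero]
      · rw [invTail, indicator_of_notMem (by simpa using ht), zero_mul]
    simp [iterK, this]

lemma monotone_iterK {κ : ℝ} (hκ : 0 ≤ κ) (n : ℕ) : Monotone (iterK κ n) := by
  induction n with
  | zero =>
    intro a b hab
    by_cases ha : 0 ≤ a
    · have hb := ha.trans hab
      simp only [iterK]
      rw [indicator_of_mem (by simpa using ha), indicator_of_mem (by simpa using hb)]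
      exact ENNReal.ofReal_le_ofReal (by gcongr)
    · rw [iterK_eq_zero κ 0 (by simpa using ha)]
      exact zero_le
  | succ n ih =>
    intro a b hab
    exact lintegral_mono fun t => by
      dsimp only
      gcongr
      exact ih (by linarith)

lemma iterK_lt_top {κ : ℝ} (hκ : 0 ≤ κ) (n : ℕ) (u : ℝ) : iterK κ n u < ⊤ := by
  induction n generalizing u with
  | zero =>
    simp only [iterK, indicator]
    split_ifs <;> simp
  | succ n ih =>
    calc iterK κ (n + 1) u ≤ ∫⁻ t, (Icc 1 u).indicator (fun _ => iterK κ n u) t := by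
          refine lintegral_mono fun t => ?_
          by_cases ht : 1 ≤ t
          · by_cases htu : t ≤ u
            · have h1 : invTail t ≤ 1 := by
                rw [invTail, indicator_of_mem (by simpa using ht)]
                exact ENNReal.ofReal_le_one.2 (inv_le_one_of_one_le₀ ht)
              rw [indicator_of_mem (mem_Icc.2 ⟨ht, htu⟩)]
              calc _ ≤ 1 * iterK κ n u := by
                    gcongr
                    exact monotone_iterK hκ n (by linarith)
                _ = _ := one_mul _
            · have : u - t < n := by
                have : (0 : ℝ) ≤ n := n.cast_nonneg
                linarith
              simp [iterK_eq_zero κ n this]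
          · simp [invTail, ht]
      _ = iterK κ n u * volume (Icc 1 u) := by
          rw [lintegral_indicator measurableSet_Icc, setLIntegral_const]
      _ < ⊤ := ENNReal.mul_lt_top (ih u) (by simp)

lemma lintegral_invTail_mul_prim {F : ℝ → ENNReal} (hF : Measurable F) (u : ℝ) :
    ∫⁻ t, invTail t * prim F (u - t) = prim (fun v => ∫⁻ t, invTail t * F (v - t)) u := by
  have h := measurable_invTail
  simp only [prim]
  rw [lintegral_lintegral_swap (by fun_prop)]
  refine lintegral_congr fun t => ?_
  rw [lintegral_const_mul _ (by fun_prop)]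
  simp only [sub_right_comm]

lemma ofReal_mul_invTail {t : ℝ} :
    ENNReal.ofReal t * invTail t = (Ici 1).indicator (fun _ => 1) t := by
  by_cases ht : 1 ≤ t
  · have h0 : (0 : ℝ) < t := by linarith
    rw [invTail, indicator_of_mem (by simpa using ht), indicator_of_mem (by simpa using ht),
      ← ENNReal.ofReal_mul h0.le, mul_inv_cancel₀ h0.ne', ENNReal.ofReal_one]
  · simp [invTail, ht]

lemma ofReal_mul_iterK_zero {κ : ℝ} (hκ : 0 ≤ κ) (u : ℝ) :
    ENNReal.ofReal u * iterK κ 0 u = ENNReal.ofReal (κ + 1) * prim (iterK κ 0) u := by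
  rcases le_or_gt u 0 with hu | hu
  · have : prim (iterK κ 0) u = 0 := by
      refine (setLIntegral_congr_fun measurableSet_Ioi (g := fun _ => 0) fun s hs => ?_).trans
        (by simp)
      exact iterK_eq_zero κ 0 (by simp only [mem_Ioi] at hs; push_cast; linarith)
    simp [this, ENNReal.ofReal_of_nonpos hu]
  · have h1 : prim (iterK κ 0) u = ∫⁻ s in Ioc 0 u, ENNReal.ofReal ((u - s) ^ κ) := by
      rw [prim, ← lintegral_indicator measurableSet_Ioi, ← lintegral_indicator measurableSet_Ioc]
      refine lintegral_congr fun s => ?_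
      simp only [indicator, iterK, mem_Ioi, mem_Ioc, mem_Ici, sub_nonneg]
      split_ifs <;> first | rfl | (exfalso; tauto)
    have hi : IntervalIntegrable (fun s : ℝ => (u - s) ^ κ) volume 0 u :=
      ((continuous_const.sub continuous_id).rpow_const fun _ => Or.inr hκ).intervalIntegrable _ _
    have h2 : ∫ s in (0 : ℝ)..u, (u - s) ^ κ = u ^ (κ + 1) / (κ + 1) := by
      rw [intervalIntegral.integral_comp_sub_left (fun x => x ^ κ), sub_self, sub_zero,
        integral_rpow (Or.inl (by linarith)), Real.zero_rpow (by linarith), sub_zero]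
    rw [h1, ← ofReal_integral_eq_lintegral_ofReal
        ((intervalIntegrable_iff_integrableOn_Ioc_of_le hu.le).1 hi),
      ← intervalIntegral.integral_of_le hu.le, h2, ← ENNReal.ofReal_mul (by linarith), iterK,
      indicator_of_mem (by simpa using hu.le), ← ENNReal.ofReal_mul hu.le]
    · congr 1
      rw [Real.rpow_add_one hu.ne']
      field_simp
    · refine (ae_restrict_iff' measurableSet_Ioc).2 (ae_of_all _ fun s hs => ?_)
      exact Real.rpow_nonneg (by linarith [hs.2]) _

lemma lintegral_indicator_Ici_mul {F : ℝ → ENNReal} (u : ℝ) :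
    ∫⁻ t, (Ici (1 : ℝ)).indicator (fun _ => 1) t * F (u - t) = prim F (u - 1) := by
  rw [prim, restrict_Ioi_eq_restrict_Ici, ← lintegral_indicator measurableSet_Ici,
    ← lintegral_sub_right_eq_self ((Ici (0 : ℝ)).indicator fun s => F (u - 1 - s)) 1]
  refine lintegral_congr fun t => ?_
  simp [indicator, sub_sub_sub_cancel_right]

/-- The integrated form of the differential-difference equation. -/
lemma ofReal_mul_iterK {κ : ℝ} (hκ : 0 ≤ κ) (n : ℕ) (u : ℝ) :
    ENNReal.ofReal u * iterK κ n u =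
      ENNReal.ofReal (κ + 1) * prim (iterK κ n) u + n * prim (iterK κ (n - 1)) (u - 1) := by
  induction n generalizing u with
  | zero => simpa using ofReal_mul_iterK_zero hκ u
  | succ n ih =>
    have hm := measurable_invTail
    have hg := measurable_iterK κ n
    have hg' := measurable_iterK κ (n - 1)
    have hp := measurable_prim hg
    have hp' := measurable_prim hg'
    have hsplit : ∀ t, ENNReal.ofReal u * (invTail t * iterK κ n (u - t)) =
        ENNReal.ofReal (κ + 1) * (invTail t * prim (iterK κ n) (u - t)) +
        n * (invTail t * prim (iterK κ (n - 1)) (u - 1 - t)) +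
        (Ici (1 : ℝ)).indicator (fun _ => 1) t * iterK κ n (u - t) := fun t => by
      have h1 : ENNReal.ofReal u * (invTail t * iterK κ n (u - t)) =
          invTail t * (ENNReal.ofReal (u - t) * iterK κ n (u - t)) +
          ENNReal.ofReal t * invTail t * iterK κ n (u - t) := by
        by_cases ht : 1 ≤ t
        · by_cases htu : t ≤ u
          · have : ENNReal.ofReal u = ENNReal.ofReal (u - t) + ENNReal.ofReal t := by
              rw [← ENNReal.ofReal_add (by linarith) (by linarith), sub_add_cancel]
            rw [this]
            ring
          · have : u - t < n := by
              have : (0 : ℝ) ≤ n := n.cast_nonneg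
              linarith
            simp [iterK_eq_zero κ n this]
        · simp [invTail, ht]
      rw [h1, ih, ofReal_mul_invTail, sub_right_comm]
      ring
    have hshift : (n : ENNReal) * ∫⁻ t, invTail t * prim (iterK κ (n - 1)) (u - 1 - t) =
        n * prim (iterK κ n) (u - 1) := by
      cases n with
      | zero => simp
      | succ m => rw [lintegral_invTail_mul_prim hg']; rfl
    have hcomm : ∫⁻ t, invTail t * prim (iterK κ n) (u - t) = prim (iterK κ (n + 1)) u :=
      lintegral_invTail_mul_prim hg u
    have hind : Measurable ((Ici (1 : ℝ)).indicator (fun _ => (1 : ENNReal))) :=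
      measurable_const.indicator measurableSet_Ici
    rw [iterK, ← lintegral_const_mul _ (by fun_prop), lintegral_congr hsplit,
      lintegral_add_left (by fun_prop), lintegral_add_left (by fun_prop),
      lintegral_const_mul _ (by fun_prop), lintegral_const_mul _ (by fun_prop), hshift, hcomm,
      lintegral_indicator_Ici_mul]
    push_cast
    ring

lemma iterK_succ_natCast {κ : ℝ} (hκ : 0 ≤ κ) (n : ℕ) : iterK κ (n + 1) ((n : ℝ) + 1) = 0 := by
  have hz : ∀ m : ℕ, prim (iterK κ m) m = 0 := fun m => by
    refine (setLIntegral_congr_fun measurableSet_Ioi (g := fun _ => 0) fun s hs => ?_).trans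
      (by simp)
    exact iterK_eq_zero κ m (by simpa using hs)
  have h := ofReal_mul_iterK hκ (n + 1) ((n : ℝ) + 1)
  have h1 := hz (n + 1)
  push_cast at h1
  rw [h1, Nat.add_sub_cancel, add_sub_cancel_right, hz n, mul_zero, mul_zero, add_zero] at h
  refine (mul_eq_zero.1 h).resolve_left ?_
  rw [ENNReal.ofReal_eq_zero, not_le]
  positivity

lemma monotone_toReal_iterK {κ : ℝ} (hκ : 0 ≤ κ) (n : ℕ) :
    Monotone fun u => (iterK κ n u).toReal := fun _ _ h =>
  ENNReal.toReal_mono (iterK_lt_top hκ n _).ne (monotone_iterK hκ n h)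

lemma intervalIntegrable_toReal_iterK {κ : ℝ} (hκ : 0 ≤ κ) (n : ℕ) (a b : ℝ) :
    IntervalIntegrable (fun u => (iterK κ n u).toReal) volume a b :=
  (monotone_toReal_iterK hκ n).intervalIntegrable

lemma prim_iterK {κ : ℝ} (hκ : 0 ≤ κ) (n : ℕ) {u : ℝ} (hu : 0 ≤ u) :
    prim (iterK κ n) u = ENNReal.ofReal (∫ v in (0 : ℝ)..u, (iterK κ n v).toReal) := by
  have hi : IntervalIntegrable (fun s => (iterK κ n (u - s)).toReal) volume 0 u := by
    refine Antitone.intervalIntegrable fun a b h => monotone_toReal_iterK hκ n ?_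
    linarith
  have h1 : ∫ v in (0 : ℝ)..u, (iterK κ n v).toReal =
      ∫ s in (0 : ℝ)..u, (iterK κ n (u - s)).toReal := by
    rw [intervalIntegral.integral_comp_sub_left (fun v => (iterK κ n v).toReal), sub_self, sub_zero]
  rw [h1, intervalIntegral.integral_of_le hu, ofReal_integral_eq_lintegral_ofReal
    ((intervalIntegrable_iff_integrableOn_Ioc_of_le hu).1 hi)
    (ae_of_all _ fun _ => ENNReal.toReal_nonneg), prim,
    ← lintegral_indicator measurableSet_Ioi, ← lintegral_indicator measurableSet_Ioc]
  refine lintegral_congr fun s => ?_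
  simp only [indicator, ENNReal.ofReal_toReal (iterK_lt_top hκ n _).ne, mem_Ioi, mem_Ioc]
  by_cases hs : 0 < s
  · by_cases hsu : s ≤ u
    · simp [hs, hsu]
    · have : u - s < n := by
        have : (0 : ℝ) ≤ n := n.cast_nonneg
        linarith
      simp [hs, hsu, iterK_eq_zero κ n this]
  · simp [hs]

lemma mul_toReal_iterK_succ {κ : ℝ} (hκ : 0 ≤ κ) (n : ℕ) {u : ℝ} (hu : 1 ≤ u) :
    u * (iterK κ (n + 1) u).toReal =
      (κ + 1) * (∫ v in (0 : ℝ)..u, (iterK κ (n + 1) v).toReal) +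
      (n + 1) * ∫ v in (0 : ℝ)..(u - 1), (iterK κ n v).toReal := by
  have h := congrArg ENNReal.toReal (ofReal_mul_iterK hκ (n + 1) u)
  have hnn : ∀ m, ∀ b : ℝ, 0 ≤ b → 0 ≤ ∫ v in (0 : ℝ)..b, (iterK κ m v).toReal := fun m b hb =>
    intervalIntegral.integral_nonneg hb fun _ _ => ENNReal.toReal_nonneg
  rw [Nat.add_sub_cancel, prim_iterK hκ _ (by linarith : 0 ≤ u),
    prim_iterK hκ _ (by linarith : 0 ≤ u - 1), ENNReal.toReal_add
      (ENNReal.mul_ne_top (by simp) (by simp))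
      (ENNReal.mul_ne_top (ENNReal.natCast_ne_top _) (by simp))] at h
  simp only [ENNReal.toReal_mul] at h
  rwa [ENNReal.toReal_ofReal (by linarith), ENNReal.toReal_ofReal (by linarith),
    ENNReal.toReal_ofReal (hnn _ _ (by linarith)), ENNReal.toReal_ofReal (hnn _ _ (by linarith)),
    ENNReal.toReal_natCast, Nat.cast_add_one] at h

lemma continuousOn_toReal_iterK_succ {κ : ℝ} (hκ : 0 ≤ κ) (n : ℕ) :
    ContinuousOn (fun u => (iterK κ (n + 1) u).toReal) (Ici 1) := by
  have hp : ∀ m, Continuous fun u => ∫ v in (0 : ℝ)..u, (iterK κ m v).toReal := fun m =>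
    intervalIntegral.continuous_primitive (fun a b => intervalIntegrable_toReal_iterK hκ m a b) 0
  have hc : ContinuousOn (fun u : ℝ =>
      ((κ + 1) * (∫ v in (0 : ℝ)..u, (iterK κ (n + 1) v).toReal) +
      (n + 1) * ∫ v in (0 : ℝ)..(u - 1), (iterK κ n v).toReal) / u) (Ici 1) := by
    refine ContinuousOn.div (Continuous.continuousOn ?_) continuousOn_id fun u hu => ?_
    · exact (continuous_const.mul (hp _)).add
        (continuous_const.mul ((hp n).comp (continuous_id.sub continuous_const)))
    · simp only [mem_Ici] at hu
      linarith
  refine hc.congr fun u hu => ?_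
  simp only [mem_Ici] at hu
  dsimp only
  rw [← mul_toReal_iterK_succ hκ n hu, mul_div_cancel_left₀ _ (by linarith)]

lemma continuousAt_toReal_iterK {κ : ℝ} (hκ : 0 ≤ κ) (n : ℕ) {u : ℝ} (hu : (n : ℝ) < u) :
    ContinuousAt (fun u => (iterK κ n u).toReal) u := by
  cases n with
  | zero =>
    have hu' : 0 < u := by simpa using hu
    refine (Real.continuousAt_rpow_const u κ (Or.inr hκ)).congr ?_
    filter_upwards [lt_mem_nhds hu'] with v hv
    rw [iterK, indicator_of_mem (by simpa using hv.le),
      ENNReal.toReal_ofReal (Real.rpow_nonneg hv.le _)]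
  | succ n =>
    refine (continuousOn_toReal_iterK_succ hκ n).continuousAt (Ici_mem_nhds ?_)
    have : (0 : ℝ) ≤ n := n.cast_nonneg
    push_cast at hu
    linarith

lemma hasDerivAt_rpow_mul_toReal_iterK {κ : ℝ} (hκ : 0 ≤ κ) (n : ℕ) {u : ℝ}
    (hu : (n : ℝ) + 1 < u) :
    HasDerivAt (fun v : ℝ => v ^ (-κ) * (iterK κ (n + 1) v).toReal)
      ((n + 1) * (u ^ (-κ - 1) * (iterK κ n (u - 1)).toReal)) u := by
  have hn : (0 : ℝ) ≤ n := n.cast_nonneg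
  have hu0 : 0 < u := by linarith
  have hp : ∀ (m : ℕ) (b : ℝ), (m : ℝ) < b →
      HasDerivAt (fun x => ∫ v in (0 : ℝ)..x, (iterK κ m v).toReal) (iterK κ m b).toReal b :=
    fun m b hb => intervalIntegral.integral_hasDerivAt_right
      (intervalIntegrable_toReal_iterK hκ m 0 b)
      (measurable_iterK κ m).ennreal_toReal.stronglyMeasurable.stronglyMeasurableAtFilter
      (continuousAt_toReal_iterK hκ m hb)
  have h1 := (hp (n + 1) u (by push_cast; linarith)).const_mul (κ + 1)
  have h2 := ((hp n (u - 1) (by linarith)).comp_sub_const u 1).const_mul ((n : ℝ) + 1)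
  have h3 := (Real.hasDerivAt_rpow_const (p := -κ - 1) (Or.inl hu0.ne')).mul (h1.add h2)
  refine (h3.congr_of_eventuallyEq ?_).congr_deriv ?_
  · filter_upwards [lt_mem_nhds (show (1 : ℝ) < u by linarith)] with v hv
    have hv0 : v ≠ 0 := by linarith
    simp only [Pi.mul_apply, Pi.add_apply]
    rw [← mul_toReal_iterK_succ hκ n hv.le, Real.rpow_sub_one hv0]
    field_simp
  · simp only [Pi.add_apply]
    rw [← mul_toReal_iterK_succ hκ n (by linarith), Real.rpow_sub_one hu0.ne' (-κ - 1)]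
    field_simp
    ring

lemma lintegral_prod_invTail_mul (κ : ℝ) (n : ℕ) (u : ℝ) :
    ∫⁻ t : Fin n → ℝ, (∏ i, invTail (t i)) * iterK κ 0 (u - ∑ i, t i) = iterK κ n u := by
  have hm := measurable_invTail
  have hg := measurable_iterK κ 0
  induction n generalizing u with
  | zero => simp [lintegral_unique, volume_pi]
  | succ n ih =>
    have hmp := (volume_preserving_piFinSuccAbove (fun _ : Fin (n + 1) => ℝ) 0).symm
    rw [← hmp.lintegral_comp (by fun_prop), Measure.volume_eq_prod, lintegral_prod _ (by fun_prop)]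
    refine lintegral_congr fun x => ?_
    rw [← ih, ← lintegral_const_mul _ (by fun_prop)]
    refine lintegral_congr fun y => ?_
    simp [MeasurableEquiv.piFinSuccAbove, Fin.insertNthEquiv, Fin.prod_univ_succ,
      Fin.sum_univ_succ, mul_assoc, sub_sub]

lemma K_eq_toReal_iterK (n : ℕ) (u κ : ℝ) :
    K n u κ = (1 / (n.factorial : ℝ)) * (iterK κ n u).toReal := by
  have hs : MeasurableSet {t : Fin n → ℝ | (∀ i, 1 ≤ t i) ∧ ∑ i, t i ≤ u} := by
    measurability
  rw [K, ← lintegral_prod_invTail_mul, integral_eq_lintegral_of_nonneg_ae,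
    ← lintegral_indicator hs]
  · congr 2
    refine lintegral_congr fun t => ?_
    by_cases h1 : ∀ i, 1 ≤ t i
    · have hpos : ∀ i, 0 ≤ (t i)⁻¹ := fun i => inv_nonneg.2 (zero_le_one.trans (h1 i))
      have hprod : ∏ i, invTail (t i) = ENNReal.ofReal (∏ i, (t i)⁻¹) := by
        rw [ENNReal.ofReal_prod_of_nonneg fun i _ => hpos i]
        exact Finset.prod_congr rfl fun i _ => indicator_of_mem (by simpa using h1 i) _
      by_cases h2 : ∑ i, t i ≤ u
      · rw [indicator_of_mem (by exact ⟨h1, h2⟩), iterK, indicator_of_mem (by simpa using h2),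
          hprod, ← ENNReal.ofReal_mul (Finset.prod_nonneg fun i _ => hpos i), Finset.prod_inv_distrib,
          div_eq_inv_mul]
      · rw [indicator_of_notMem (by simp [h2]), iterK_eq_zero κ 0 (by simpa using h2), mul_zero]
    · rw [indicator_of_notMem (by exact fun h => h1 h.1)]
      obtain ⟨i, hi⟩ := not_forall.1 h1
      have h0 : invTail (t i) = 0 := indicator_of_notMem (by simpa using hi) _
      rw [Finset.prod_eq_zero (Finset.mem_univ i) h0, zero_mul]
  · refine (ae_restrict_iff' hs).2 (ae_of_all _ fun t ht => ?_)
    exact div_nonneg (Real.rpow_nonneg (by linarith [ht.2]) _)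
      (Finset.prod_nonneg fun i _ => zero_le_one.trans (ht.1 i))
  · exact Measurable.aestronglyMeasurable (by fun_prop)

theorem stmt_10 (ℓ : ℕ) (hℓ : 1 ≤ ℓ) (κ : ℝ) (hκ : 0 ≤ κ) (u : ℝ) (hu : (ℓ : ℝ) < u) :
    HasDerivAt (fun v : ℝ => v ^ (-κ) * K ℓ v κ)
      (u ^ (-κ - 1) * K (ℓ - 1) (u - 1) κ) u ∧
    K ℓ u κ = u ^ κ * ∫ t in (ℓ : ℝ)..u, t ^ (-κ - 1) * K (ℓ - 1) (t - 1) κ := by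
  obtain ⟨n, rfl⟩ : ∃ n, ℓ = n + 1 := ⟨ℓ - 1, by omega⟩
  have hn : (0 : ℝ) ≤ n := n.cast_nonneg
  simp only [Nat.add_sub_cancel, Nat.cast_add_one] at hu ⊢
  have hderiv : ∀ x : ℝ, (n : ℝ) + 1 < x → HasDerivAt (fun v : ℝ => v ^ (-κ) * K (n + 1) v κ)
      (x ^ (-κ - 1) * K n (x - 1) κ) x := fun x hx => by
    have hK : (fun v : ℝ => v ^ (-κ) * K (n + 1) v κ) = fun v =>
        (1 / ((n + 1).factorial : ℝ)) * (v ^ (-κ) * (iterK κ (n + 1) v).toReal) := by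
      funext v
      rw [K_eq_toReal_iterK]
      ring
    rw [hK]
    refine ((hasDerivAt_rpow_mul_toReal_iterK hκ n hx).const_mul _).congr_deriv ?_
    rw [K_eq_toReal_iterK, Nat.factorial_succ]
    have : (n.factorial : ℝ) ≠ 0 := by positivity
    push_cast
    field_simp
  have hpow : ∀ p : ℝ, ContinuousOn (fun v : ℝ => v ^ p) (Icc (n + 1) u) := fun p v hv =>
    (Real.continuousAt_rpow_const v p
      (Or.inl (by linarith [hv.1]))).continuousWithinAt
  refine ⟨hderiv u hu, ?_⟩
  have hFTC := intervalIntegral.integral_eq_sub_of_hasDerivAt_of_le hu.le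
    (f := fun v : ℝ => v ^ (-κ) * K (n + 1) v κ) (f' := fun x => x ^ (-κ - 1) * K n (x - 1) κ)
    ?_ (fun x hx => hderiv x hx.1) ?_
  · rw [hFTC, K_eq_toReal_iterK (n + 1) (n + 1), iterK_succ_natCast hκ, ENNReal.toReal_zero,
      mul_zero, mul_zero, sub_zero, ← mul_assoc, ← Real.rpow_add (by linarith), add_neg_cancel,
      Real.rpow_zero, one_mul]
  · refine (hpow _).mul ?_
    simp only [K_eq_toReal_iterK]
    exact continuousOn_const.mul ((continuousOn_toReal_iterK_succ hκ n).mono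
      fun x hx => by simp only [mem_Ici]; linarith [hx.1])
  · refine IntervalIntegrable.continuousOn_mul ?_ (by rw [uIcc_of_le hu.le]; exact hpow _)
    simp only [K_eq_toReal_iterK]
    refine IntervalIntegrable.const_mul (Monotone.intervalIntegrable fun a b h => ?_) _
    exact monotone_toReal_iterK hκ n (by linarith)
end

section
/- For any c > 0, integer κ ≥ 0, and real λ ≠ 0, one has (Γ(κ+1)/(2πi)) ∫_{c−i∞}^{c+i∞} e^{λs} s^{−κ−1} ds = λ^κ if λ > 0 and 0 if λ < 0, where for κ = 0 the integral is interpreted as a Cauchy principal value. -/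
open MeasureTheory Filter

/-- A point on the vertical line through `c ≠ 0` is nonzero. -/
lemma ofReal_add_mul_I_ne_zero {c : ℝ} (hc : c ≠ 0) (t : ℝ) :
    (c : ℂ) + t * Complex.I ≠ 0 := by
  intro h
  apply hc
  simpa using congrArg Complex.re h

lemma abs_le_norm_ofReal_add_mul_I (x t : ℝ) : |t| ≤ ‖(x : ℂ) + t * Complex.I‖ := by
  simpa using Complex.abs_im_le_norm ((x : ℂ) + t * Complex.I)

lemma norm_exp_ofReal_mul_add_mul_I (lam x t : ℝ) :
    ‖Complex.exp ((lam : ℂ) * ((x : ℂ) + t * Complex.I))‖ = Real.exp (lam * x) := by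
  simp [Complex.norm_exp]

lemma continuous_exp_mul_zpow_vertical {c : ℝ} (hc : c ≠ 0) (lam : ℝ) (n : ℤ) :
    Continuous (fun t : ℝ => Complex.exp ((lam : ℂ) * ((c : ℂ) + t * Complex.I)) *
      ((c : ℂ) + t * Complex.I) ^ n) := by
  refine Continuous.mul (by fun_prop) ?_
  exact Continuous.zpow₀ (by fun_prop) n fun t => Or.inl (ofReal_add_mul_I_ne_zero hc t)

/-- Integrating `exp (λ s) / s` over a horizontal segment, for `λ < 0`. -/
lemma norm_integral_horizontal_le {lam : ℝ} (hlam : lam < 0) {a b : ℝ} (hab : a ≤ b)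
    {y : ℝ} (hy : y ≠ 0) :
    ‖∫ x in a..b, Complex.exp ((lam : ℂ) * ((x : ℂ) + y * Complex.I)) *
      ((x : ℂ) + y * Complex.I)⁻¹‖ ≤ Real.exp (lam * a) / (-lam) * |y|⁻¹ := by
  have hy' : 0 < |y| := abs_pos.mpr hy
  calc _ ≤ ∫ x in a..b, Real.exp (lam * x) * |y|⁻¹ := by
        apply intervalIntegral.norm_integral_le_of_norm_le hab
        · refine Eventually.of_forall fun x _ => ?_
          rw [norm_mul, norm_exp_ofReal_mul_add_mul_I, norm_inv]
          gcongr
          exact abs_le_norm_ofReal_add_mul_I x y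
        · exact (by fun_prop : Continuous fun x => Real.exp (lam * x) * |y|⁻¹).intervalIntegrable _ _
    _ = (Real.exp (lam * a) - Real.exp (lam * b)) / (-lam) * |y|⁻¹ := by
        rw [intervalIntegral.integral_mul_const, intervalIntegral.integral_comp_mul_left _ hlam.ne,
          integral_exp, smul_eq_mul]
        field_simp
        ring
    _ ≤ _ := by
        have : 0 < -lam := by linarith
        gcongr
        linarith [Real.exp_pos (lam * b)]

/-- For `λ < 0` the principal value of `exp (λ s) / s` over a vertical line in the right
half-plane vanishes. -/
lemma tendsto_integral_exp_mul_inv_vertical_of_neg {c : ℝ} (hc : 0 < c) {lam : ℝ}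
    (hlam : lam < 0) :
    Tendsto (fun T : ℝ => ∫ t in -T..T, Complex.exp ((lam : ℂ) * ((c : ℂ) + t * Complex.I)) *
      ((c : ℂ) + t * Complex.I)⁻¹) atTop (nhds 0) := by
  have hbound : Tendsto (fun T : ℝ => 2 * (Real.exp (lam * c) / (-lam) * T⁻¹) +
      2 * Real.exp (lam * T)) atTop (nhds 0) := by
    have h1 := (tendsto_inv_atTop_zero (𝕜 := ℝ)).const_mul (Real.exp (lam * c) / (-lam))
    have h2 : Tendsto (fun T : ℝ => Real.exp (lam * T)) atTop (nhds 0) :=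
      Real.tendsto_exp_atBot.comp (tendsto_id.const_mul_atTop_of_neg hlam)
    simpa using (h1.const_mul 2).add (h2.const_mul 2)
  refine squeeze_zero_norm' ?_ hbound
  filter_upwards [eventually_gt_atTop 0] with T hT
  set f : ℂ → ℂ := fun s => Complex.exp ((lam : ℂ) * s) * s⁻¹ with hf
  have hrect := Complex.integral_boundary_rect_eq_zero_of_differentiableOn f
    ((c : ℂ) + ((-T : ℝ) : ℂ) * Complex.I) (((c + T : ℝ) : ℂ) + (T : ℂ) * Complex.I) (by
      intro s hs
      have hs0 : s ≠ 0 := by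
        rintro rfl
        have := hs.1
        rw [Set.mem_preimage, Set.mem_uIcc] at this
        simp at this
        rcases this with h | h <;> linarith
      apply DifferentiableAt.differentiableWithinAt
      have : DifferentiableAt ℂ (fun z : ℂ => z⁻¹) s := differentiableAt_inv hs0
      fun_prop)
  have hre (a b : ℝ) : ((a : ℂ) + (b : ℂ) * Complex.I).re = a := by simp
  have him (a b : ℝ) : ((a : ℂ) + (b : ℂ) * Complex.I).im = b := by simp
  simp only [hre, him, smul_eq_mul] at hrect
  have hb := norm_integral_horizontal_le hlam (by linarith : c ≤ c + T) (neg_ne_zero.mpr hT.ne')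
  have ht := norm_integral_horizontal_le hlam (by linarith : c ≤ c + T) hT.ne'
  rw [abs_neg] at hb
  rw [abs_of_pos hT] at hb ht
  have hr : ‖∫ y in -T..T, f (((c + T : ℝ) : ℂ) + y * Complex.I)‖ ≤ 2 * Real.exp (lam * T) := by
    have hle : ∀ y ∈ Set.uIoc (-T) T, ‖f (((c + T : ℝ) : ℂ) + y * Complex.I)‖ ≤
        Real.exp (lam * T) * T⁻¹ := by
      intro y _
      rw [hf, norm_mul, norm_exp_ofReal_mul_add_mul_I, norm_inv]
      have h1 : T ≤ ‖((c + T : ℝ) : ℂ) + y * Complex.I‖ := by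
        have := Complex.re_le_norm (((c + T : ℝ) : ℂ) + y * Complex.I)
        rw [hre] at this
        linarith
      gcongr ?_ * ?_
      · exact Real.exp_le_exp.mpr (by nlinarith)
      · gcongr
    refine (intervalIntegral.norm_integral_le_of_norm_le_const hle).trans_eq ?_
    rw [abs_of_pos (by linarith)]
    field_simp
    ring
  have hI : ‖∫ t in -T..T, f ((c : ℂ) + t * Complex.I)‖ =
      ‖Complex.I * ∫ t in -T..T, f ((c : ℂ) + t * Complex.I)‖ := by simp
  change ‖∫ t in -T..T, f ((c : ℂ) + t * Complex.I)‖ ≤ _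
  have heq := sub_eq_zero.mp hrect
  rw [hI, ← heq]
  refine (norm_add_le _ _).trans ?_
  refine (add_le_add (norm_sub_le _ _) le_rfl).trans ?_
  rw [norm_mul, Complex.norm_I, one_mul]
  linarith

/-- The principal value of `1 / s` over a vertical line in the right half-plane. -/
lemma tendsto_integral_inv_vertical {c : ℝ} (hc : 0 < c) :
    Tendsto (fun T : ℝ => ∫ t in -T..T, ((c : ℂ) + t * Complex.I)⁻¹) atTop
      (nhds (Real.pi : ℂ)) := by
  have harctan (T : ℝ) : ∫ t in -T..T, ((c : ℂ) + t * Complex.I)⁻¹ =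
      ((2 * Real.arctan (T / c) : ℝ) : ℂ) := by
    have hcont : Continuous fun t : ℝ => ((c : ℂ) + t * Complex.I)⁻¹ :=
      Continuous.inv₀ (by fun_prop) (ofReal_add_mul_I_ne_zero hc.ne')
    have hcont' : Continuous fun t : ℝ => ((c : ℂ) + (-t : ℝ) * Complex.I)⁻¹ :=
      hcont.comp continuous_neg
    have hneg : ∫ t in -T..T, ((c : ℂ) + t * Complex.I)⁻¹ =
        ∫ t in -T..T, ((c : ℂ) + (-t : ℝ) * Complex.I)⁻¹ := by
      rw [intervalIntegral.integral_comp_neg fun t : ℝ => ((c : ℂ) + t * Complex.I)⁻¹, neg_neg]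
    have hsum : (∫ t in -T..T, ((c : ℂ) + t * Complex.I)⁻¹) +
        ∫ t in -T..T, ((c : ℂ) + (-t : ℝ) * Complex.I)⁻¹ =
        ∫ t in -T..T, ((2 * (c⁻¹ * (1 / (1 + (t / c) ^ 2))) : ℝ) : ℂ) := by
      rw [← intervalIntegral.integral_add (hcont.intervalIntegrable _ _)
        (hcont'.intervalIntegrable _ _)]
      congr 1
      ext t
      have h1 := ofReal_add_mul_I_ne_zero hc.ne' t
      have h2 := ofReal_add_mul_I_ne_zero hc.ne' (-t)
      have h3 : (c : ℂ) ^ 2 + (t : ℂ) ^ 2 ≠ 0 := by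
        have : c ^ 2 + t ^ 2 ≠ 0 := by positivity
        exact_mod_cast this
      have h4 : (c : ℂ) ≠ 0 := by exact_mod_cast hc.ne'
      have h5 : 1 + ((t : ℂ) / c) ^ 2 = (c ^ 2 + t ^ 2) / c ^ 2 := by field_simp
      push_cast at h2 ⊢
      rw [h5, inv_add_inv h1 h2]
      have h6 : ((c : ℂ) + t * Complex.I) * (c + -t * Complex.I) = c ^ 2 + t ^ 2 := by
        ring_nf
        rw [Complex.I_sq]
        ring
      rw [h6]
      field_simp
      ring
    rw [← hneg, intervalIntegral.integral_ofReal, intervalIntegral.integral_const_mul,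
      intervalIntegral.integral_const_mul, intervalIntegral.integral_comp_div
        (fun x => 1 / (1 + x ^ 2)) hc.ne', integral_one_div_one_add_sq, neg_div, Real.arctan_neg,
      smul_eq_mul, inv_mul_cancel_left₀ hc.ne'] at hsum
    push_cast at hsum ⊢
    linear_combination hsum / 2
  simp_rw [harctan]
  have h : Tendsto (fun T : ℝ => 2 * Real.arctan (T / c)) atTop (nhds Real.pi) := by
    have := ((Real.tendsto_arctan_atTop.mono_right nhdsWithin_le_nhds).comp
      (tendsto_id.atTop_div_const hc)).const_mul 2
    rwa [mul_div_cancel₀ _ (two_ne_zero' ℝ)] at this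
  exact (Complex.continuous_ofReal.tendsto _).comp h

/-- The substitution `s ↦ -s` in the integral of `exp (λ s) / s` over a vertical segment. -/
lemma integral_exp_mul_inv_vertical_neg (c lam T : ℝ) :
    ∫ t in -T..T, Complex.exp ((lam : ℂ) * (((-c : ℝ) : ℂ) + t * Complex.I)) *
      (((-c : ℝ) : ℂ) + t * Complex.I)⁻¹ =
    -∫ t in -T..T, Complex.exp (((-lam : ℝ) : ℂ) * ((c : ℂ) + t * Complex.I)) *
      ((c : ℂ) + t * Complex.I)⁻¹ := by
  have h := intervalIntegral.integral_comp_neg (a := -T) (b := T)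
    fun t : ℝ => Complex.exp ((lam : ℂ) * (((-c : ℝ) : ℂ) + t * Complex.I)) *
      (((-c : ℝ) : ℂ) + t * Complex.I)⁻¹
  rw [neg_neg] at h
  rw [← h, ← intervalIntegral.integral_neg]
  congr 1
  ext t
  have h1 : ((-c : ℝ) : ℂ) + (-t : ℝ) * Complex.I = -((c : ℂ) + t * Complex.I) := by
    push_cast; ring
  rw [h1, inv_neg, mul_neg, Complex.ofReal_neg, neg_mul, mul_neg]

/-- Moving the contour for the entire function `(exp (λ s) - 1) / s` between the vertical lines
through `-c` and `c` does not change the principal value. -/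
lemma tendsto_integral_dslope_exp_vertical_sub {c : ℝ} (hc : 0 < c) {lam : ℝ} (hlam : 0 < lam) :
    Tendsto (fun T : ℝ =>
      (∫ t in -T..T, dslope (fun s : ℂ => Complex.exp ((lam : ℂ) * s)) 0
        ((c : ℂ) + t * Complex.I)) -
      ∫ t in -T..T, dslope (fun s : ℂ => Complex.exp ((lam : ℂ) * s)) 0
        (((-c : ℝ) : ℂ) + t * Complex.I)) atTop (nhds 0) := by
  set g := dslope (fun s : ℂ => Complex.exp ((lam : ℂ) * s)) 0 with hg
  have hgd : Differentiable ℂ g := by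
    rw [← differentiableOn_univ, hg, Complex.differentiableOn_dslope Filter.univ_mem]
    fun_prop
  set M := (Real.exp (lam * c) + 1) * (2 * c) with hM
  have hbound : Tendsto (fun T : ℝ => 2 * (M * T⁻¹)) atTop (nhds 0) := by
    simpa using ((tendsto_inv_atTop_zero (𝕜 := ℝ)).const_mul M).const_mul 2
  refine squeeze_zero_norm' ?_ hbound
  filter_upwards [eventually_gt_atTop 0] with T hT
  have hrect := Complex.integral_boundary_rect_eq_zero_of_differentiableOn g
    (((-c : ℝ) : ℂ) + ((-T : ℝ) : ℂ) * Complex.I) ((c : ℂ) + (T : ℂ) * Complex.I)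
    hgd.differentiableOn
  have hre (a b : ℝ) : ((a : ℂ) + (b : ℂ) * Complex.I).re = a := by simp
  have him (a b : ℝ) : ((a : ℂ) + (b : ℂ) * Complex.I).im = b := by simp
  simp only [hre, him, smul_eq_mul] at hrect
  have hhor (y : ℝ) (hy : |y| = T) :
      ‖∫ x in -c..c, g ((x : ℂ) + y * Complex.I)‖ ≤ M * T⁻¹ := by
    have hle : ∀ x ∈ Set.uIoc (-c) c, ‖g ((x : ℂ) + y * Complex.I)‖ ≤
        (Real.exp (lam * c) + 1) * T⁻¹ := by
      intro x hx
      rw [Set.uIoc_of_le (by linarith)] at hx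
      have hn := abs_le_norm_ofReal_add_mul_I x y
      rw [hy] at hn
      have h0 : (x : ℂ) + y * Complex.I ≠ 0 := norm_pos_iff.mp (hT.trans_le hn)
      rw [hg, dslope_of_ne _ h0, slope_def_field, div_eq_mul_inv, norm_mul, norm_inv, sub_zero]
      gcongr
      refine (norm_sub_le _ _).trans ?_
      rw [norm_exp_ofReal_mul_add_mul_I]
      simp only [mul_zero, Complex.exp_zero, norm_one]
      gcongr
      exact hx.2
    refine (intervalIntegral.norm_integral_le_of_norm_le_const hle).trans_eq ?_
    rw [abs_of_pos (by linarith), hM]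
    ring
  have hb := hhor (-T) (by rw [abs_neg, abs_of_pos hT])
  have ht := hhor T (abs_of_pos hT)
  set P := ∫ t in -T..T, g ((c : ℂ) + t * Complex.I)
  set Q := ∫ t in -T..T, g (((-c : ℝ) : ℂ) + t * Complex.I)
  have hI : ‖P - Q‖ = ‖Complex.I * (P - Q)‖ := by simp
  have heq : Complex.I * (P - Q) = (∫ x in -c..c, g ((x : ℂ) + T * Complex.I)) -
      ∫ x in -c..c, g ((x : ℂ) + ((-T : ℝ) : ℂ) * Complex.I) := by
    linear_combination hrect
  rw [hI, heq]
  refine (norm_sub_le _ _).trans ?_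
  linarith

/-- For `λ > 0` the principal value of `exp (λ s) / s` over a vertical line in the right
half-plane, parametrised by the imaginary part, is `2π`. -/
lemma tendsto_integral_exp_mul_inv_vertical_of_pos {c : ℝ} (hc : 0 < c) {lam : ℝ}
    (hlam : 0 < lam) :
    Tendsto (fun T : ℝ => ∫ t in -T..T, Complex.exp ((lam : ℂ) * ((c : ℂ) + t * Complex.I)) *
      ((c : ℂ) + t * Complex.I)⁻¹) atTop (nhds (2 * Real.pi)) := by
  have hsplit {d : ℝ} (hd : d ≠ 0) (T : ℝ) :
      ∫ t in -T..T, dslope (fun s : ℂ => Complex.exp ((lam : ℂ) * s)) 0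
        ((d : ℂ) + t * Complex.I) =
      (∫ t in -T..T, Complex.exp ((lam : ℂ) * ((d : ℂ) + t * Complex.I)) *
        ((d : ℂ) + t * Complex.I)⁻¹) - ∫ t in -T..T, ((d : ℂ) + t * Complex.I)⁻¹ := by
    have h1 := continuous_exp_mul_zpow_vertical hd lam (-1)
    have h2 : Continuous fun t : ℝ => ((d : ℂ) + t * Complex.I)⁻¹ :=
      Continuous.inv₀ (by fun_prop) (ofReal_add_mul_I_ne_zero hd)
    simp_rw [zpow_neg_one] at h1
    rw [← intervalIntegral.integral_sub (h1.intervalIntegrable _ _) (h2.intervalIntegrable _ _)]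
    congr 1
    ext t
    rw [dslope_of_ne _ (ofReal_add_mul_I_ne_zero hd t), slope_def_field]
    simp only [mul_zero, Complex.exp_zero, sub_zero]
    rw [div_eq_mul_inv, sub_mul, one_mul]
  have hinv (T : ℝ) : ∫ t in -T..T, (((-c : ℝ) : ℂ) + t * Complex.I)⁻¹ =
      -∫ t in -T..T, ((c : ℂ) + t * Complex.I)⁻¹ := by
    simpa using integral_exp_mul_inv_vertical_neg c 0 T
  have h := ((tendsto_integral_dslope_exp_vertical_sub hc hlam).add
    ((tendsto_integral_inv_vertical hc).const_mul 2)).sub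
    (tendsto_integral_exp_mul_inv_vertical_of_neg hc (neg_lt_zero.mpr hlam))
  rw [zero_add, sub_zero] at h
  refine h.congr fun T => ?_
  rw [hsplit hc.ne', hsplit (neg_ne_zero.mpr hc.ne'), hinv, integral_exp_mul_inv_vertical_neg]
  ring

/-- Integration by parts for `exp (λ s) * s ^ (-(κ + 1))` along a vertical line. -/
lemma integral_exp_mul_zpow_vertical_succ {c : ℝ} (hc : c ≠ 0) (lam : ℝ) (κ : ℕ) (T : ℝ) :
    ((κ : ℂ) + 1) * ∫ t in -T..T, Complex.exp ((lam : ℂ) * ((c : ℂ) + t * Complex.I)) *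
        ((c : ℂ) + t * Complex.I) ^ (-((κ + 1 : ℕ) + 1 : ℤ)) * Complex.I =
      lam * (∫ t in -T..T, Complex.exp ((lam : ℂ) * ((c : ℂ) + t * Complex.I)) *
        ((c : ℂ) + t * Complex.I) ^ (-(κ + 1 : ℤ)) * Complex.I) -
      (Complex.exp ((lam : ℂ) * ((c : ℂ) + (T : ℝ) * Complex.I)) *
          ((c : ℂ) + (T : ℝ) * Complex.I) ^ (-(κ + 1 : ℤ)) -
        Complex.exp ((lam : ℂ) * ((c : ℂ) + (-T : ℝ) * Complex.I)) *
          ((c : ℂ) + (-T : ℝ) * Complex.I) ^ (-(κ + 1 : ℤ))) := by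
  have hint (n : ℤ) : IntervalIntegrable (fun t : ℝ =>
      Complex.exp ((lam : ℂ) * ((c : ℂ) + t * Complex.I)) *
        ((c : ℂ) + t * Complex.I) ^ n * Complex.I) volume (-T) T :=
    ((continuous_exp_mul_zpow_vertical hc lam n).mul continuous_const).intervalIntegrable _ _
  have hderiv (t : ℝ) : HasDerivAt (fun t : ℝ =>
      Complex.exp ((lam : ℂ) * ((c : ℂ) + t * Complex.I)) *
        ((c : ℂ) + t * Complex.I) ^ (-(κ + 1 : ℤ)))
      (lam * (Complex.exp ((lam : ℂ) * ((c : ℂ) + t * Complex.I)) *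
        ((c : ℂ) + t * Complex.I) ^ (-(κ + 1 : ℤ)) * Complex.I) -
      ((κ : ℂ) + 1) * (Complex.exp ((lam : ℂ) * ((c : ℂ) + t * Complex.I)) *
        ((c : ℂ) + t * Complex.I) ^ (-((κ + 1 : ℕ) + 1 : ℤ)) * Complex.I)) t := by
    have hs : HasDerivAt (fun t : ℝ => (c : ℂ) + t * Complex.I) Complex.I t := by
      simpa using ((Complex.ofRealCLM.hasDerivAt (x := t)).mul_const Complex.I).const_add (c : ℂ)
    have hz := (hasDerivAt_zpow (-(κ + 1 : ℤ)) ((c : ℂ) + t * Complex.I)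
      (Or.inl (ofReal_add_mul_I_ne_zero hc t))).comp t hs
    have := ((hs.const_mul (lam : ℂ)).cexp).mul hz
    refine this.congr_deriv ?_
    rw [show -(κ + 1 : ℤ) - 1 = -((κ + 1 : ℕ) + 1 : ℤ) by push_cast; ring]
    simp only [Function.comp_apply]
    push_cast
    ring
  have h := intervalIntegral.integral_eq_sub_of_hasDerivAt (a := -T) (b := T)
    (fun t _ => hderiv t) (((hint _).const_mul _).sub ((hint _).const_mul _))
  rw [intervalIntegral.integral_sub ((hint _).const_mul _) ((hint _).const_mul _),
    intervalIntegral.integral_const_mul, intervalIntegral.integral_const_mul] at h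
  linear_combination -h

lemma tendsto_exp_mul_zpow_vertical {l : Filter ℝ} (c lam : ℝ) (κ : ℕ) {u : ℝ → ℝ}
    (hu : Tendsto (fun T => |u T|) l atTop) :
    Tendsto (fun T : ℝ => Complex.exp ((lam : ℂ) * ((c : ℂ) + (u T : ℝ) * Complex.I)) *
      ((c : ℂ) + (u T : ℝ) * Complex.I) ^ (-(κ + 1 : ℤ))) l (nhds 0) := by
  have hn : Tendsto (fun T => ‖(c : ℂ) + (u T : ℝ) * Complex.I‖) l atTop :=
    tendsto_atTop_mono (fun T => abs_le_norm_ofReal_add_mul_I c (u T)) hu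
  have h := ((tendsto_pow_neg_atTop (𝕜 := ℝ) (Nat.succ_ne_zero κ)).comp hn).const_mul
    (Real.exp (lam * c))
  rw [mul_zero] at h
  refine tendsto_zero_iff_norm_tendsto_zero.mpr (h.congr fun T => ?_)
  rw [norm_mul, norm_exp_ofReal_mul_add_mul_I, norm_zpow]
  simp

theorem stmt_14 (c : ℝ) (hc : 0 < c) (κ : ℕ) (lam : ℝ) (hlam : lam ≠ 0) :
    Tendsto (fun T : ℝ =>
        Complex.Gamma ((κ : ℂ) + 1) / (2 * Real.pi * Complex.I) *
          ∫ t in -T..T, Complex.exp ((lam : ℂ) * ((c : ℂ) + t * Complex.I)) *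
            ((c : ℂ) + t * Complex.I) ^ (-(κ + 1 : ℤ)) * Complex.I)
      atTop (nhds (if 0 < lam then ((lam : ℂ)) ^ κ else 0)) := by
  have hpi : (Real.pi : ℂ) ≠ 0 := by exact_mod_cast Real.pi_ne_zero
  induction κ with
  | zero =>
    have key : Tendsto (fun T : ℝ => ∫ t in -T..T,
        Complex.exp ((lam : ℂ) * ((c : ℂ) + t * Complex.I)) * ((c : ℂ) + t * Complex.I)⁻¹)
        atTop (nhds (if 0 < lam then 2 * Real.pi else 0)) := by
      split_ifs with h
      · exact tendsto_integral_exp_mul_inv_vertical_of_pos hc h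
      · exact tendsto_integral_exp_mul_inv_vertical_of_neg hc
          (lt_of_le_of_ne (not_lt.mp h) hlam)
    have h := key.const_mul (2 * (Real.pi : ℂ))⁻¹
    convert h using 2 with T
    · simp only [Nat.cast_zero, zero_add, Complex.Gamma_one, zpow_neg_one,
        intervalIntegral.integral_mul_const]
      field_simp
    · split_ifs
      · field_simp
      · simp
  | succ κ ih =>
    have hb := (tendsto_exp_mul_zpow_vertical c lam κ (u := fun T => T)
      tendsto_abs_atTop_atTop).sub
      (tendsto_exp_mul_zpow_vertical c lam κ (u := fun T => -T)
        (by simpa using tendsto_abs_atTop_atTop))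
    have h := (ih.const_mul (lam : ℂ)).sub (hb.const_mul
      (Complex.Gamma ((κ : ℂ) + 1) / (2 * Real.pi * Complex.I)))
    convert h using 2 with T
    · have hparts := integral_exp_mul_zpow_vertical_succ hc.ne' lam κ T
      have hΓ := Complex.Gamma_add_one ((κ : ℂ) + 1) (by exact_mod_cast Nat.succ_ne_zero κ)
      rw [Nat.cast_succ, hΓ]
      linear_combination (Complex.Gamma ((κ : ℂ) + 1) / (2 * Real.pi * Complex.I)) * hparts
    · split_ifs
      · ring
      · simp
end
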